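/- One has ψ(X', y, z) + φ(X', y, z) ≥ 0 and ψ(X', y, z) − φ(X', y, z) ≥ 0 for every (X', y, z) ∈ ℝ^{n+1} ∖ Q'. -/

import Mathlib

open MeasureTheory Real
open scoped BigOperators ENNReal NNReal

noncomputable section

/-- First directional derivative of `g` at `x` in direction `e`. -/
def pd1 {W : Type*} [NormedAddCommGroup W] [NormedSpace ℝ W]
    (e : W) (g : W → ℝ) (x : W) : ℝ :=
  deriv (fun t : ℝ => g (x + t • e)) 0

/-- Second directional derivative of `g` at `x` in direction `e`. -/
def pd2 {W : Type*} [NormedAddCommGroup W] [NormedSpace ℝ W]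
    (e : W) (g : W → ℝ) (x : W) : ℝ :=
  deriv (deriv (fun t : ℝ => g (x + t • e))) 0

/-- Normalizing constant of the fractional Laplacian. -/
def fracC (N : ℕ) (s : ℝ) : ℝ :=
  2 ^ (2 * s - 1) * Real.Gamma (s + (N : ℝ) / 2) /
    (π ^ ((N : ℝ) / 2) * |Real.Gamma (-s)|)

/-- Constant `c̃_{N,s}`. -/
def ctilde (N : ℕ) (s : ℝ) : ℝ :=
  2 ^ s * Real.Gamma (s + 1) * Real.Gamma ((N : ℝ) / 2 + s) / Real.Gamma ((N : ℝ) / 2)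

/-- The integrand of the fractional Laplacian of order `s` acting through the embedding `inc`. -/
def fracKer {W : Type*} [NormedAddCommGroup W] [NormedSpace ℝ W]
    (N : ℕ) (s : ℝ) (inc : EuclideanSpace ℝ (Fin N) → W) (g : W → ℝ) (x : W)
    (y : EuclideanSpace ℝ (Fin N)) : ℝ :=
  (2 * g x - g (x + inc y) - g (x - inc y)) / ‖y‖ ^ ((N : ℝ) + 2 * s)

/-- Fractional Laplacian (`s ∈ (0,1)`) in the coordinates described by `inc`. -/
def fracLap {W : Type*} [NormedAddCommGroup W] [NormedSpace ℝ W]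
    (N : ℕ) (s : ℝ) (inc : EuclideanSpace ℝ (Fin N) → W) (g : W → ℝ) (x : W) : ℝ :=
  fracC N s * ∫ y : EuclideanSpace ℝ (Fin N), fracKer N s inc g x y

/-- Classical (negative) Laplacian in the coordinates described by `inc`. -/
def classLap {W : Type*} [NormedAddCommGroup W] [NormedSpace ℝ W]
    (N : ℕ) (inc : EuclideanSpace ℝ (Fin N) → W) (g : W → ℝ) (x : W) : ℝ :=
  -∑ j : Fin N, pd2 (inc (EuclideanSpace.single j 1)) g x

/-- `(-Δ)^s` in the coordinates described by `inc`, for `s ∈ (0,1]`. -/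
def sLap {W : Type*} [NormedAddCommGroup W] [NormedSpace ℝ W]
    (N : ℕ) (s : ℝ) (inc : EuclideanSpace ℝ (Fin N) → W) (g : W → ℝ) (x : W) : ℝ :=
  if s = 1 then classLap N inc g x else fracLap N s inc g x

/-- Sup norm on the whole space. -/
def supAbs {α : Type*} (g : α → ℝ) : ℝ := ⨆ x, |g x|

/-- Sup norm on a set. -/
def supAbsOn {α : Type*} (A : Set α) (g : α → ℝ) : ℝ := ⨆ x ∈ A, |g x|

/-- Hölder seminorm of exponent `γ` on a set. -/
def holderSemi {α : Type*} [NormedAddCommGroup α] (γ : ℝ) (A : Set α) (g : α → ℝ) : ℝ :=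
  ⨆ x ∈ A, ⨆ y ∈ A, |g x - g y| / ‖x - y‖ ^ γ

/-- Hölder norm `‖·‖_{C^γ(A)}`, `γ ∈ (0,1)`. -/
def holderNorm {α : Type*} [NormedAddCommGroup α] (γ : ℝ) (A : Set α) (g : α → ℝ) : ℝ :=
  supAbsOn A g + holderSemi γ A g

/-- `ℝ^{n-1}` split into the groups of variables `X_1,…,X_{m-1}`. -/
abbrev VS (m' : ℕ) (N : Fin m' → ℕ) : Type :=
  PiLp 2 (fun i : Fin m' => EuclideanSpace ℝ (Fin (N i)))

/-- `ℝ^n = ℝ^{n-1} × ℝ`, with the Euclidean norm. -/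
abbrev WS (m' : ℕ) (N : Fin m' → ℕ) : Type := WithLp 2 (VS m' N × ℝ)

variable (m' : ℕ) (N : Fin m' → ℕ)

/-- Build a point of `ℝ^n` from `X' ∈ ℝ^{n-1}` and a last coordinate `t`. -/
def toW (X' : VS m' N) (t : ℝ) : WS m' N := (WithLp.equiv 2 _).symm (X', t)

/-- The group `X_i` of coordinates of `x ∈ ℝⁿ`. -/
def Xc (x : WS m' N) : VS m' N := (WithLp.equiv 2 _ x).1

/-- The last coordinate `x_n` of `x ∈ ℝⁿ`. -/
def tc (x : WS m' N) : ℝ := (WithLp.equiv 2 _ x).2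

/-- The direction `e_n` of the last coordinate. -/
def lastE : WS m' N := toW m' N 0 1

/-- The increment `y^{(i)} ∈ ℝⁿ` induced by `y ∈ ℝ^{N_i}`. -/
def grpIncr (i : Fin m') (y : EuclideanSpace ℝ (Fin (N i))) : WS m' N :=
  (WithLp.equiv 2 _).symm ((WithLp.equiv 2 _).symm (Pi.single i y), 0)

/-- The operator `L = ∑ aᵢ (-Δ_{X_i})^{sᵢ} - ∂²_{x_n}`. -/
def Lop (a s : Fin m' → ℝ) (u : WS m' N → ℝ) (x : WS m' N) : ℝ :=
  (∑ i, a i * sLap (N i) (s i) (grpIncr m' N i) u x) - pd2 (lastE m' N) u x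

/-- The box `Q_d`. -/
def QdSet (d : Fin m' → ℝ) (dm : ℝ) : Set (WS m' N) :=
  {x | (∀ i, ‖Xc m' N x i‖ < d i) ∧ |tc m' N x| < dm}

/-- The constant `κ`. -/
def kap (a s d : Fin m' → ℝ) (dm : ℝ) (u : WS m' N → ℝ) : ℝ :=
  (4 / 3) * (supAbsOn (QdSet m' N d dm) (Lop m' N a s u)
    + (∑ i, supAbs u / (1 - (3 / 4 : ℝ) ^ (s i)) * (ctilde (N i) (s i) / (d i) ^ (2 * s i)))
    + supAbs u / (1 - (3 / 4 : ℝ) ^ (1 : ℝ)) * (ctilde 1 1 / dm ^ (2 : ℝ)))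

end

noncomputable section
variable (m' : ℕ) (N : Fin m' → ℕ)

/-- The extended space `ℝ^{n+1} = ℝ^{n-1}_{X'} × ℝ_y × ℝ_z`. -/
abbrev ES (m' : ℕ) (N : Fin m' → ℕ) : Type := VS m' N × ℝ × ℝ

/-- The increment `y^{(i)}` inside the extended space. -/
def grpIncrE (i : Fin m') (y : EuclideanSpace ℝ (Fin (N i))) : ES m' N :=
  ((WithLp.equiv 2 _).symm (Pi.single i y), 0, 0)

/-- The direction of the variable `y` in the extended space. -/
def eY : ES m' N := (0, 1, 0)

/-- The direction of the variable `z` in the extended space. -/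
def eZ : ES m' N := (0, 0, 1)

/-- The extended operator `ℒ = ∑ aᵢ (-Δ_{X_i})^{sᵢ} - (1/2)∂²_y - (1/2)∂²_z`. -/
def calL (a s : Fin m' → ℝ) (g : ES m' N → ℝ) (p : ES m' N) : ℝ :=
  (∑ i, a i * sLap (N i) (s i) (grpIncrE m' N i) g p)
    - (1 / 2) * pd2 (eY m' N) g p - (1 / 2) * pd2 (eZ m' N) g p

/-- The extended box `Q'`. -/
def QpSet (d : Fin m' → ℝ) (dm : ℝ) : Set (ES m' N) :=
  {p | (∀ i, ‖p.1 i‖ < d i / 2) ∧ p.2.1 ∈ Set.Ioo 0 (dm / 4) ∧ p.2.2 ∈ Set.Ioo 0 (dm / 4)}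

/-- The barrier `φ`. -/
def phiB (u : WS m' N → ℝ) (p : ES m' N) : ℝ :=
  (1 / 4) * (u (toW m' N p.1 (max p.2.1 0 + max p.2.2 0))
    - u (toW m' N p.1 (max p.2.1 0 - max p.2.2 0))
    - u (toW m' N p.1 (-max p.2.1 0 + max p.2.2 0))
    + u (toW m' N p.1 (-max p.2.1 0 - max p.2.2 0)))

/-- The barrier `ψ`. -/
def psiB (a s d : Fin m' → ℝ) (dm : ℝ) (u : WS m' N → ℝ) (p : ES m' N) : ℝ :=
  (∑ i, supAbs u / (1 - (3 / 4 : ℝ) ^ s i)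
      * (1 - (max (1 - ‖p.1 i‖ ^ 2 / d i ^ 2) 0) ^ s i))
    + 4 * supAbs (pd1 (lastE m' N) u) * (max p.2.1 0 * max p.2.2 0) / dm
    + kap m' N a s d dm u * max p.2.1 0 * max p.2.2 0
      * |Real.log (2 * dm / (max p.2.1 0 + max p.2.2 0))|

end

lemma abs_le_supAbs {α : Type*} {g : α → ℝ} (hg : ∃ M, ∀ x, |g x| ≤ M) (x : α) :
    |g x| ≤ supAbs g := by
  obtain ⟨M, hM⟩ := hg
  exact le_ciSup (f := fun x => |g x|) ⟨M, by rintro _ ⟨y, rfl⟩; exact hM y⟩ x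

lemma supAbs_nonneg {α : Type*} (g : α → ℝ) : 0 ≤ supAbs g :=
  Real.iSup_nonneg fun _ => abs_nonneg _

lemma supAbsOn_nonneg {α : Type*} (A : Set α) (g : α → ℝ) : 0 ≤ supAbsOn A g :=
  Real.iSup_nonneg fun _ => Real.iSup_nonneg fun _ => abs_nonneg _

lemma ctilde_nonneg (N : ℕ) {s : ℝ} (hs : 0 ≤ s) : 0 ≤ ctilde N s := by
  have h1 := Real.Gamma_nonneg_of_nonneg (show 0 ≤ s + 1 by positivity)
  have h2 := Real.Gamma_nonneg_of_nonneg (show 0 ≤ (N : ℝ) / 2 + s by positivity)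
  have h3 := Real.Gamma_nonneg_of_nonneg (show 0 ≤ (N : ℝ) / 2 by positivity)
  unfold ctilde
  positivity

lemma one_sub_three_quarters_rpow_pos {s : ℝ} (hs : 0 < s) : 0 < 1 - (3 / 4 : ℝ) ^ s :=
  sub_pos.2 (Real.rpow_lt_one (by norm_num) (by norm_num) hs)

lemma kap_nonneg (m' : ℕ) (N : Fin m' → ℕ) (a s d : Fin m' → ℝ) (hs : ∀ i, 0 < s i)
    (hd : ∀ i, 0 < d i) {dm : ℝ} (hdm : 0 < dm) (u : WS m' N → ℝ) :
    0 ≤ kap m' N a s d dm u := by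
  have hterm : ∀ (k : ℕ) {σ δ e : ℝ}, 0 < σ → 0 < δ →
      0 ≤ supAbs u / (1 - (3 / 4 : ℝ) ^ σ) * (ctilde k σ / δ ^ e) := fun k σ δ e hσ hδ =>
    mul_nonneg (div_nonneg (supAbs_nonneg u) (one_sub_three_quarters_rpow_pos hσ).le)
      (div_nonneg (ctilde_nonneg k hσ.le) (Real.rpow_nonneg hδ.le e))
  exact mul_nonneg (by norm_num) (add_nonneg (add_nonneg (supAbsOn_nonneg _ _)
    (Finset.sum_nonneg fun i _ => hterm (N i) (hs i) (hd i))) (hterm 1 one_pos hdm))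

lemma toW_add_smul_lastE (m' : ℕ) (N : Fin m' → ℕ) (X : VS m' N) (t r : ℝ) :
    toW m' N X t + r • lastE m' N = toW m' N X (t + r) := by
  simp [toW, lastE, ← WithLp.toLp_smul, ← WithLp.toLp_add]

/-- A function with bounded last partial derivative is Lipschitz in the last coordinate. -/
lemma abs_sub_le_supAbs_pd1_mul (m' : ℕ) (N : Fin m' → ℕ) (u : WS m' N → ℝ)
    (hu : ∀ x : WS m' N, DifferentiableAt ℝ (fun t : ℝ => u (x + t • lastE m' N)) 0)
    (hb : ∃ M, ∀ x, |pd1 (lastE m' N) u x| ≤ M) (X : VS m' N) (t r : ℝ) :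
    |u (toW m' N X t) - u (toW m' N X r)| ≤ supAbs (pd1 (lastE m' N) u) * |t - r| := by
  have hderiv (τ : ℝ) : HasDerivAt (fun t => u (toW m' N X t))
      (pd1 (lastE m' N) u (toW m' N X τ)) τ := by
    have h := (hu (toW m' N X τ)).hasDerivAt
    simp only [toW_add_smul_lastE] at h
    have h' := HasDerivAt.comp_sub_const τ τ
      (f := fun r => u (toW m' N X (τ + r))) (by rw [sub_self]; exact h)
    simpa only [pd1, toW_add_smul_lastE, add_sub_cancel] using h'
  exact Convex.norm_image_sub_le_of_norm_hasDerivWithin_le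
    (fun τ _ => (hderiv τ).hasDerivWithinAt) (fun τ _ => abs_le_supAbs hb _) convex_univ
    (Set.mem_univ r) (Set.mem_univ t)

/-- The fractional-power cutoff takes values in `[0, 1]`. -/
lemma cutoff_rpow_le_one {s : ℝ} (hs : 0 ≤ s) (r d : ℝ) :
    (max (1 - r ^ 2 / d ^ 2) 0) ^ s ≤ 1 :=
  Real.rpow_le_one (le_max_right _ _)
    (max_le (sub_le_self _ (by positivity)) zero_le_one) hs

lemma cutoff_rpow_le {s r d : ℝ} (hs : 0 ≤ s) (hd : 0 < d) (hr : d / 2 ≤ r) :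
    (max (1 - r ^ 2 / d ^ 2) 0) ^ s ≤ (3 / 4 : ℝ) ^ s := by
  refine Real.rpow_le_rpow (le_max_right _ _) (max_le ?_ (by norm_num)) hs
  have : 1 / 4 ≤ r ^ 2 / d ^ 2 := by
    rw [le_div_iff₀ (by positivity)]
    nlinarith
  linarith

lemma abs_phiB_le_supAbs (m' : ℕ) (N : Fin m' → ℕ) (u : WS m' N → ℝ)
    (hu : ∃ M, ∀ x, |u x| ≤ M) (p : ES m' N) : |phiB m' N u p| ≤ supAbs u := by
  have h x := abs_le.1 (abs_le_supAbs hu x)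
  have h1 := h (toW m' N p.1 (max p.2.1 0 + max p.2.2 0))
  have h2 := h (toW m' N p.1 (max p.2.1 0 - max p.2.2 0))
  have h3 := h (toW m' N p.1 (-max p.2.1 0 + max p.2.2 0))
  have h4 := h (toW m' N p.1 (-max p.2.1 0 - max p.2.2 0))
  unfold phiB
  rw [abs_le]
  constructor <;> linarith

lemma abs_phiB_le_supAbs_pd1_mul (m' : ℕ) (N : Fin m' → ℕ) (u : WS m' N → ℝ)
    (hu : ∀ x : WS m' N, DifferentiableAt ℝ (fun t : ℝ => u (x + t • lastE m' N)) 0)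
    (hb : ∃ M, ∀ x, |pd1 (lastE m' N) u x| ≤ M) (p : ES m' N) :
    |phiB m' N u p| ≤
      supAbs (pd1 (lastE m' N) u) * min (max p.2.1 0) (max p.2.2 0) := by
  have hy : 0 ≤ max p.2.1 0 := le_max_right _ _
  have hz : 0 ≤ max p.2.2 0 := le_max_right _ _
  unfold phiB
  generalize max p.2.1 0 = y at *
  generalize max p.2.2 0 = z at *
  have key (t r c : ℝ) (hc : 0 ≤ c) (htr : t - r = 2 * c) :=
    abs_le.1 (htr ▸ abs_sub_le_supAbs_pd1_mul m' N u hu hb p.1 t r)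
  have habs {c : ℝ} (hc : 0 ≤ c) : |2 * c| = 2 * c := abs_of_nonneg (by positivity)
  rcases min_cases y z with ⟨h, -⟩ | ⟨h, -⟩ <;> rw [h, abs_le]
  · have h1 := key (y + z) (-y + z) y hy (by ring)
    have h2 := key (y - z) (-y - z) y hy (by ring)
    rw [habs hy] at h1 h2
    constructor <;> linarith [h1.1, h1.2, h2.1, h2.2]
  · have h1 := key (y + z) (y - z) z hz (by ring)
    have h2 := key (-y + z) (-y - z) z hz (by ring)
    rw [habs hz] at h1 h2
    constructor <;> linarith [h1.1, h1.2, h2.1, h2.2]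

/-- **Barrier comparison outside `Q'`.** `ψ ± φ ≥ 0` on `ℝ^{n+1} ∖ Q'`. -/
theorem barrier_comparison_outside
    (m' : ℕ) (hm' : 1 ≤ m') (N : Fin m' → ℕ) (hN : ∀ i, 0 < N i)
    (a : Fin m' → ℝ) (ha : ∀ i, 0 ≤ a i)
    (s : Fin m' → ℝ) (hs : ∀ i, s i ∈ Set.Ioc (0 : ℝ) 1)
    (d : Fin m' → ℝ) (hd : ∀ i, 0 < d i) (dm : ℝ) (hdm : 0 < dm)
    (u : WS m' N → ℝ)
    (hu_bdd : ∃ M, ∀ x, |u x| ≤ M)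
    (hu_cont : Continuous u)
    (hu_dn : ∀ x : WS m' N, DifferentiableAt ℝ (fun t : ℝ => u (x + t • lastE m' N)) 0)
    (hdn_bdd : ∃ M, ∀ x, |pd1 (lastE m' N) u x| ≤ M)
    (hu_C2 : ∃ U : Set (WS m' N), IsOpen U ∧ closure (QdSet m' N d dm) ⊆ U ∧
      ContDiffOn ℝ 2 u U)
    (hu_int : ∀ x ∈ QdSet m' N d dm, ∀ i, s i < 1 →
      Integrable (fracKer (N i) (s i) (grpIncr m' N i) u x)) :
    ∀ p ∉ QpSet m' N d dm,
      0 ≤ psiB m' N a s d dm u p + phiB m' N u p ∧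
      0 ≤ psiB m' N a s d dm u p - phiB m' N u p := by
  intro p hp
  have hs0 i : 0 < s i := (hs i).1
  suffices h : |phiB m' N u p| ≤ psiB m' N a s d dm u p by
    have := abs_le.1 h
    constructor <;> linarith
  have hD := supAbs_nonneg (pd1 (lastE m' N) u)
  have hy : 0 ≤ max p.2.1 0 := le_max_right _ _
  have hz : 0 ≤ max p.2.2 0 := le_max_right _ _
  have hcut (i : Fin m') : 0 ≤ supAbs u / (1 - (3 / 4 : ℝ) ^ s i)
      * (1 - (max (1 - ‖p.1 i‖ ^ 2 / d i ^ 2) 0) ^ s i) :=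
    mul_nonneg (div_nonneg (supAbs_nonneg u) (one_sub_three_quarters_rpow_pos (hs0 i)).le)
      (sub_nonneg.2 (cutoff_rpow_le_one (hs0 i).le _ _))
  have hgrad : 0 ≤ 4 * supAbs (pd1 (lastE m' N) u) * (max p.2.1 0 * max p.2.2 0) / dm := by
    positivity
  have hlog : 0 ≤ kap m' N a s d dm u * max p.2.1 0 * max p.2.2 0
      * |Real.log (2 * dm / (max p.2.1 0 + max p.2.2 0))| :=
    mul_nonneg (mul_nonneg (mul_nonneg (kap_nonneg m' N a s d hs0 hd hdm u) hy) hz)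
      (abs_nonneg _)
  have hsum := Finset.sum_nonneg fun i (_ : i ∈ Finset.univ) => hcut i
  unfold psiB
  by_cases hX : ∀ i, ‖p.1 i‖ < d i / 2
  · have hphi := abs_phiB_le_supAbs_pd1_mul m' N u hu_dn hdn_bdd p
    suffices hmin : min (max p.2.1 0) (max p.2.2 0) * dm
        ≤ 4 * (max p.2.1 0 * max p.2.2 0) by
      have : supAbs (pd1 (lastE m' N) u) * min (max p.2.1 0) (max p.2.2 0)
          ≤ 4 * supAbs (pd1 (lastE m' N) u) * (max p.2.1 0 * max p.2.2 0) / dm := by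
        rw [le_div_iff₀ hdm]
        nlinarith [mul_le_mul_of_nonneg_left hmin hD]
      linarith
    by_cases hyI : p.2.1 ∈ Set.Ioo 0 (dm / 4)
    · have hzI : p.2.2 ≤ 0 ∨ dm / 4 ≤ p.2.2 := by
        by_contra! h
        exact hp ⟨hX, hyI, h⟩
      rcases hzI with h | h
      · simp [max_eq_right h]
      · nlinarith [min_le_left (max p.2.1 0) (max p.2.2 0), le_max_left p.2.2 0]
    · have hyI' : p.2.1 ≤ 0 ∨ dm / 4 ≤ p.2.1 := by
        by_contra! h
        exact hyI h
      rcases hyI' with h | h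
      · simp [max_eq_right h]
      · nlinarith [min_le_right (max p.2.1 0) (max p.2.2 0), le_max_left p.2.1 0]
  · push Not at hX
    obtain ⟨i, hi⟩ := hX
    have hpos := one_sub_three_quarters_rpow_pos (hs0 i)
    have hterm : supAbs u ≤ supAbs u / (1 - (3 / 4 : ℝ) ^ s i)
        * (1 - (max (1 - ‖p.1 i‖ ^ 2 / d i ^ 2) 0) ^ s i) := by
      calc supAbs u = supAbs u / (1 - (3 / 4 : ℝ) ^ s i) * (1 - (3 / 4 : ℝ) ^ s i) :=
            (div_mul_cancel₀ _ hpos.ne').symm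
        _ ≤ _ := mul_le_mul_of_nonneg_left
            (sub_le_sub_left (cutoff_rpow_le (hs0 i).le (hd i) hi) 1)
            (div_nonneg (supAbs_nonneg u) hpos.le)
    have hle := Finset.single_le_sum (fun i _ => hcut i) (Finset.mem_univ i)
    linarith [abs_phiB_le_supAbs m' N u hu_bdd p]
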